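/- Let K ≥ 1, α ∈ (0,1), and a₁, …, a_K > 0. Let S₁, …, S_K be independent real random variables with S_k Gamma(2,a_k)-distributed, let M = max_{1≤k≤K} S_k, and let Y be uniformly distributed on [0, α²] and independent of (S₁,…,S_K). Then E[log(1 + (M^{-1} + Y)^{-1})] = (1/α²)·∑_{k=1}^{K} a_k²·∫₀^∞ Υ^{MRT}(x)·x·e^{-a_k·x}·∏_{j≠k} γ(2, a_j·x) dx. (This is the ergodic rate of the first user selected by the Max-Gain User Selection scheme in multi-user mode with maximum-ratio transmission, with a_k = σ²/g_k.) -/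

import Mathlib

open MeasureTheory Real Set
open scoped ENNReal

/-- The Gamma(2, a) law: density `a² · x · e^{-a·x}` on `(0, ∞)` (shape 2, rate `a`). -/
noncomputable def gammaLaw (a : ℝ) : Measure ℝ :=
  volume.withDensity fun x =>
    ENNReal.ofReal (if 0 < x then a ^ 2 * x * Real.exp (-(a * x)) else 0)

/-- The uniform law on the real interval `[lo, hi]`. -/
noncomputable def unifLaw (lo hi : ℝ) : Measure ℝ :=
  (ENNReal.ofReal (hi - lo))⁻¹ • volume.restrict (Set.Icc lo hi)

/-- The lower incomplete gamma function with shape 2: `γ(2, z) = 1 - (z+1)·e^{-z}`. -/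
noncomputable def lGamma2 (z : ℝ) : ℝ := 1 - (z + 1) * Real.exp (-z)

/-- `Υ^{MRT}(x)` for orthogonality parameter `α`. -/
noncomputable def UpsMRT (α x : ℝ) : ℝ :=
  Real.log ((1 + x + α ^ 2 * x) / (1 + x))
    + (1 / x) * Real.log ((1 + (x⁻¹ + α ^ 2)⁻¹) / (1 + x))
    + α ^ 2 * Real.log (1 + (x⁻¹ + α ^ 2)⁻¹)

theorem gammaLaw_eq_gammaMeasure {a : ℝ} :
    gammaLaw a = ProbabilityTheory.gammaMeasure 2 a := by
  unfold gammaLaw ProbabilityTheory.gammaMeasure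
  congr 1
  ext x
  rw [ProbabilityTheory.gammaPDF_eq]
  congr 1
  rcases lt_trichotomy x 0 with hx | rfl | hx
  · simp [hx.not_gt, hx.not_ge]
  · norm_num
  · rw [if_pos hx, if_pos hx.le]
    norm_num [Real.Gamma_two]

theorem isProbabilityMeasure_gammaLaw {a : ℝ} (ha : 0 < a) :
    IsProbabilityMeasure (gammaLaw a) := by
  rw [gammaLaw_eq_gammaMeasure]
  exact ProbabilityTheory.isProbabilityMeasure_gammaMeasure two_pos ha

theorem isProbabilityMeasure_unifLaw {lo hi : ℝ} (h : lo < hi) :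
    IsProbabilityMeasure (unifLaw lo hi) := by
  refine ⟨?_⟩
  have h0 : ENNReal.ofReal (hi - lo) ≠ 0 := by simpa using h
  simp [unifLaw, ENNReal.inv_mul_cancel h0 ENNReal.ofReal_ne_top]

theorem setLIntegral_Iic_ite_pos_deriv {G g : ℝ → ℝ} (hG : ∀ x, HasDerivAt G (g x) x)
    (hg : Continuous g) (hG0 : G 0 = 0) (hpos : ∀ x, 0 < x → 0 ≤ g x) (x : ℝ) :
    ∫⁻ t in Iic x, ENNReal.ofReal (if 0 < t then g t else 0) = ENNReal.ofReal (G (max 0 x)) := by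
  have hind : (fun t => ENNReal.ofReal (if 0 < t then g t else 0))
      = (Ioi (0 : ℝ)).indicator fun t => ENNReal.ofReal (g t) := by
    ext t
    by_cases ht : 0 < t <;> simp [indicator, ht]
  have hset : Ioi (0 : ℝ) ∩ Iic x = Ioc 0 (max 0 x) := by
    ext t
    simp only [mem_inter_iff, mem_Ioi, mem_Iic, mem_Ioc, le_max_iff]
    constructor
    · exact fun h => ⟨h.1, Or.inr h.2⟩
    · exact fun h => ⟨h.1, h.2.resolve_left h.1.not_ge⟩
  have hint : IntegrableOn g (Ioc 0 (max 0 x)) :=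
    (hg.integrableOn_Icc).mono_set Ioc_subset_Icc_self
  rw [hind, setLIntegral_indicator measurableSet_Ioi, hset,
    ← ofReal_integral_eq_lintegral_ofReal hint,
    ← intervalIntegral.integral_of_le (le_max_left 0 x),
    intervalIntegral.integral_eq_sub_of_hasDerivAt (fun t _ => hG t)
      (hg.intervalIntegrable _ _), hG0, sub_zero]
  exact (ae_restrict_iff' measurableSet_Ioc).2 (ae_of_all _ fun t ht => hpos t ht.1)

theorem hasDerivAt_lGamma2 (z : ℝ) : HasDerivAt lGamma2 (z * Real.exp (-z)) z := by
  have h := (((hasDerivAt_id z).add_const 1).mul (hasDerivAt_id z).neg.exp).const_sub 1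
  refine h.congr_deriv ?_
  simp
  ring

theorem hasDerivAt_lGamma2_const_mul (a x : ℝ) :
    HasDerivAt (fun x => lGamma2 (a * x)) (a ^ 2 * x * Real.exp (-(a * x))) x := by
  have h := (hasDerivAt_lGamma2 (a * x)).comp x ((hasDerivAt_id x).const_mul a)
  refine h.congr_deriv ?_
  simp
  ring

@[fun_prop]
theorem continuous_lGamma2 : Continuous lGamma2 :=
  continuous_iff_continuousAt.2 fun z => (hasDerivAt_lGamma2 z).continuousAt

theorem lGamma2_zero : lGamma2 0 = 0 := by simp [lGamma2]

theorem lGamma2_nonneg (z : ℝ) : 0 ≤ lGamma2 z := by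
  have h := mul_le_mul_of_nonneg_right (Real.add_one_le_exp z) (Real.exp_pos (-z)).le
  rw [← Real.exp_add, add_neg_cancel, Real.exp_zero] at h
  unfold lGamma2
  linarith

theorem lGamma2_le_one {z : ℝ} (hz : 0 ≤ z) : lGamma2 z ≤ 1 := by
  have : 0 ≤ (z + 1) * Real.exp (-z) := mul_nonneg (add_nonneg hz zero_le_one) (Real.exp_pos _).le
  unfold lGamma2
  linarith

theorem gammaLaw_Iic {a : ℝ} (ha : 0 < a) (x : ℝ) :
    gammaLaw a (Iic x) = ENNReal.ofReal (lGamma2 (a * max 0 x)) := by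
  rw [gammaLaw, withDensity_apply _ measurableSet_Iic]
  exact setLIntegral_Iic_ite_pos_deriv (hasDerivAt_lGamma2_const_mul a) (by fun_prop)
    (by simp [lGamma2_zero]) (fun x hx => by positivity) x

/-- The `k`-th summand of the density of the maximum of independent `Gamma(2, a j)` variables:
the contribution of the event that the `k`-th variable is the largest. -/
noncomputable def maxGammaDensityTerm {ι : Type*} [Fintype ι] [DecidableEq ι] (a : ι → ℝ) (k : ι)
    (x : ℝ) : ℝ :=
  a k ^ 2 * x * Real.exp (-(a k * x)) * ∏ j ∈ Finset.univ.erase k, lGamma2 (a j * x)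

section MaxGamma

variable {ι : Type*} [Fintype ι] [DecidableEq ι] {a : ι → ℝ}

@[fun_prop]
theorem continuous_maxGammaDensityTerm (a : ι → ℝ) (k : ι) :
    Continuous (maxGammaDensityTerm a k) := by
  unfold maxGammaDensityTerm
  fun_prop

theorem maxGammaDensityTerm_nonneg (a : ι → ℝ) (k : ι) {x : ℝ} (hx : 0 < x) :
    0 ≤ maxGammaDensityTerm a k x := by
  have h : 0 ≤ ∏ j ∈ Finset.univ.erase k, lGamma2 (a j * x) :=
    Finset.prod_nonneg fun j _ => lGamma2_nonneg _
  unfold maxGammaDensityTerm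
  positivity

theorem maxGammaDensityTerm_le (ha : ∀ k, 0 < a k) (k : ι) {x : ℝ} (hx : 0 < x) :
    maxGammaDensityTerm a k x ≤ a k ^ 2 * x * Real.exp (-(a k * x)) :=
  mul_le_of_le_one_right (by positivity)
    (Finset.prod_le_one (fun j _ => lGamma2_nonneg _)
      fun j _ => lGamma2_le_one (mul_pos (ha j) hx).le)

theorem hasDerivAt_prod_lGamma2 (a : ι → ℝ) (x : ℝ) :
    HasDerivAt (fun x => ∏ k, lGamma2 (a k * x)) (∑ k, maxGammaDensityTerm a k x) x := by
  have h := HasDerivAt.fun_finsetProd (u := Finset.univ)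
    fun k _ => hasDerivAt_lGamma2_const_mul (a k) x
  refine h.congr_deriv (Finset.sum_congr rfl fun k _ => ?_)
  rw [maxGammaDensityTerm, smul_eq_mul, mul_comm]

/-- The law of the maximum of independent `Gamma(2, a k)` variables. -/
theorem map_iSup_pi_gammaLaw [Nonempty ι] (ha : ∀ k, 0 < a k) :
    (Measure.pi fun k => gammaLaw (a k)).map (fun s : ι → ℝ => ⨆ k, s k)
      = volume.withDensity fun x =>
          ENNReal.ofReal (if 0 < x then ∑ k, maxGammaDensityTerm a k x else 0) := by
  have := fun k => isProbabilityMeasure_gammaLaw (ha k)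
  have hmeas : Measurable fun s : ι → ℝ => ⨆ k, s k :=
    Measurable.iSup fun k => measurable_pi_apply k
  have := Measure.isProbabilityMeasure_map (μ := Measure.pi fun k => gammaLaw (a k))
    hmeas.aemeasurable
  refine Measure.ext_of_Iic _ _ fun x => ?_
  have hpre : (fun s : ι → ℝ => ⨆ k, s k) ⁻¹' Iic x = Set.univ.pi fun _ => Iic x := by
    ext s
    simp [ciSup_le_iff (Set.finite_range s).bddAbove, Pi.le_def]
  rw [Measure.map_apply hmeas measurableSet_Iic, hpre, Measure.pi_pi,
    withDensity_apply _ measurableSet_Iic,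
    setLIntegral_Iic_ite_pos_deriv (hasDerivAt_prod_lGamma2 a) (by fun_prop)
      (by simp [lGamma2_zero]) fun x hx =>
        Finset.sum_nonneg fun k _ => maxGammaDensityTerm_nonneg a k hx]
  simp_rw [gammaLaw_Iic (ha _)]
  rw [ENNReal.ofReal_prod_of_nonneg fun k _ => lGamma2_nonneg _]

theorem integrableOn_maxGammaDensityTerm_mul_id (ha : ∀ k, 0 < a k) (k : ι) :
    IntegrableOn (fun x => maxGammaDensityTerm a k x * x) (Ioi 0) := by
  have h := (integrableOn_rpow_mul_exp_neg_mul_rpow (p := 1) (s := 2) (by norm_num) one_pos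
    (ha k)).const_mul (a k ^ 2)
  refine h.mono' (by fun_prop) ((ae_restrict_iff' measurableSet_Ioi).2 (ae_of_all _ ?_))
  intro x (hx : 0 < x)
  rw [Real.norm_of_nonneg (mul_nonneg (maxGammaDensityTerm_nonneg a k hx) hx.le)]
  calc maxGammaDensityTerm a k x * x ≤ a k ^ 2 * x * Real.exp (-(a k * x)) * x :=
        mul_le_mul_of_nonneg_right (maxGammaDensityTerm_le ha k hx) hx.le
    _ = a k ^ 2 * (x ^ (2 : ℝ) * Real.exp (-a k * x ^ (1 : ℝ))) := by
        rw [Real.rpow_one, Real.rpow_two, neg_mul]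
        ring

end MaxGamma

theorem withDensity_ite_pos_eq_restrict (g : ℝ → ℝ) :
    (volume.withDensity fun x => ENNReal.ofReal (if 0 < x then g x else 0))
      = (volume.restrict (Ioi 0)).withDensity fun x => ENNReal.ofReal (g x) := by
  rw [← withDensity_indicator measurableSet_Ioi]
  congr 1
  ext t
  by_cases ht : 0 < t <;> simp [indicator, ht]

theorem log_one_add_inv_nonneg {x y : ℝ} (hx : 0 < x) (hy : 0 ≤ y) :
    0 ≤ Real.log (1 + (x⁻¹ + y)⁻¹) :=
  Real.log_nonneg (le_add_of_nonneg_right (by positivity))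

theorem log_one_add_inv_le {x y : ℝ} (hx : 0 < x) (hy : 0 ≤ y) :
    Real.log (1 + (x⁻¹ + y)⁻¹) ≤ x := by
  have h1 : (x⁻¹ + y)⁻¹ ≤ x := inv_le_of_inv_le₀ hx (le_add_of_nonneg_right hy)
  have h2 := Real.log_le_sub_one_of_pos (x := 1 + (x⁻¹ + y)⁻¹) (by positivity)
  linarith

theorem integral_log_one_add_inv {α x : ℝ} (hx : 0 < x) :
    ∫ y in Icc 0 (α ^ 2), Real.log (1 + (x⁻¹ + y)⁻¹) = UpsMRT α x := by
  have hb : 0 ≤ α ^ 2 := sq_nonneg α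
  have hlog : ∀ y, 0 ≤ y → Real.log (1 + (x⁻¹ + y)⁻¹)
      = Real.log (1 + x⁻¹ + y) - Real.log (x⁻¹ + y) := by
    intro y hy
    rw [← Real.log_div (by positivity) (by positivity)]
    congr 1
    have : x⁻¹ + y ≠ 0 := by positivity
    rw [eq_div_iff this, add_mul, inv_mul_cancel₀ this]
    ring
  have hderiv : ∀ y ∈ uIcc 0 (α ^ 2), HasDerivAt
      (fun y => (1 + x⁻¹ + y) * Real.log (1 + x⁻¹ + y) - (x⁻¹ + y) * Real.log (x⁻¹ + y))
      (Real.log (1 + (x⁻¹ + y)⁻¹)) y := by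
    intro y hy
    rw [uIcc_of_le hb] at hy
    have hy0 := hy.1
    have h1 := (Real.hasDerivAt_mul_log (x := 1 + x⁻¹ + y) (by positivity)).comp y
      ((hasDerivAt_id y).const_add (1 + x⁻¹))
    have h2 := (Real.hasDerivAt_mul_log (x := x⁻¹ + y) (by positivity)).comp y
      ((hasDerivAt_id y).const_add x⁻¹)
    refine (h1.sub h2).congr_deriv ?_
    rw [hlog y hy0]
    ring
  have hcont : ContinuousOn (fun y => Real.log (1 + (x⁻¹ + y)⁻¹)) (uIcc 0 (α ^ 2)) := by
    rw [uIcc_of_le hb]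
    have hne : ∀ y ∈ Icc 0 (α ^ 2), x⁻¹ + y ≠ 0 := fun y hy => by
      have := hy.1
      positivity
    have hne' : ∀ y ∈ Icc 0 (α ^ 2), 1 + (x⁻¹ + y)⁻¹ ≠ 0 := fun y hy => by
      have := hy.1
      positivity
    fun_prop (disch := assumption)
  rw [integral_Icc_eq_integral_Ioc, ← intervalIntegral.integral_of_le hb,
    intervalIntegral.integral_eq_sub_of_hasDerivAt hderiv hcont.intervalIntegrable]
  have e1 : Real.log ((1 + x + α ^ 2 * x) / (1 + x))
      = Real.log (1 + x⁻¹ + α ^ 2) - Real.log (1 + x⁻¹) := by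
    rw [← Real.log_div (by positivity) (by positivity)]
    congr 1
    field_simp
    ring
  have e2 : Real.log ((1 + (x⁻¹ + α ^ 2)⁻¹) / (1 + x))
      = Real.log (1 + x⁻¹ + α ^ 2) - Real.log (x⁻¹ + α ^ 2)
        - (Real.log (1 + x⁻¹) - Real.log x⁻¹) := by
    rw [Real.log_div (by positivity) (by positivity), hlog _ hb,
      ← Real.log_div (x := 1 + x⁻¹) (by positivity) (by positivity)]
    congr 2
    field_simp
    ring
  rw [UpsMRT, e1, e2, hlog _ hb, one_div]
  simp only [add_zero]
  ring

theorem integral_unifLaw_log_one_add_inv {α x : ℝ} (hx : 0 < x) :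
    ∫ y, Real.log (1 + (x⁻¹ + y)⁻¹) ∂unifLaw 0 (α ^ 2) = 1 / α ^ 2 * UpsMRT α x := by
  rw [unifLaw, integral_smul_measure, integral_log_one_add_inv hx, sub_zero, ENNReal.toReal_inv,
    ENNReal.toReal_ofReal (sq_nonneg α), smul_eq_mul, one_div]

/-- Ergodic rate of the first user selected by the MUS scheme in
multi-user mode with maximum-ratio transmission: `S₁, …, S_K` independent with
`S_k ~ Gamma(2, a_k)`, `M = max_k S_k`, `Y ~ Uniform[0, α²]` independent of the `S_k`
(joint law the product of the marginals). Then
`E[log(1 + (M⁻¹ + Y)⁻¹)]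
  = (1/α²)·∑_k a_k²·∫₀^∞ Υ^{MRT}(x)·x·e^{-a_k·x}·∏_{j≠k} γ(2, a_j·x) dx`. -/
theorem mus_mu_mode_mrt_first_user_rate {Ω : Type*} [MeasurableSpace Ω]
    (μ : Measure Ω) [IsProbabilityMeasure μ]
    (K : ℕ) (hK : 1 ≤ K) (α : ℝ) (hα : α ∈ Set.Ioo (0 : ℝ) 1)
    (a : Fin K → ℝ) (ha : ∀ k, 0 < a k)
    (S : Fin K → Ω → ℝ) (Y : Ω → ℝ)
    (hSmeas : ∀ k, Measurable (S k)) (hYmeas : Measurable Y)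
    (hlaw : Measure.map (fun ω => ((fun k => S k ω, Y ω) : (Fin K → ℝ) × ℝ)) μ
      = (Measure.pi fun k => gammaLaw (a k)).prod (unifLaw 0 (α ^ 2))) :
    ∫ ω, Real.log (1 + ((⨆ k, S k ω)⁻¹ + Y ω)⁻¹) ∂μ
      = (1 / α ^ 2) * ∑ k : Fin K, (a k) ^ 2 *
          ∫ x in Set.Ioi (0 : ℝ),
            UpsMRT α x * x * Real.exp (-(a k * x)) *
              ∏ j ∈ Finset.univ.erase k, lGamma2 (a j * x) := by
  have : Nonempty (Fin K) := ⟨⟨0, hK⟩⟩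
  have hb : 0 < α ^ 2 := pow_pos hα.1 2
  have := fun k => isProbabilityMeasure_gammaLaw (ha k)
  have := isProbabilityMeasure_unifLaw hb
  have hsup : Measurable fun s : Fin K → ℝ => ⨆ k, s k :=
    Measurable.iSup fun k => measurable_pi_apply k
  have hf : Measurable fun p : ℝ × ℝ => Real.log (1 + (p.1⁻¹ + p.2)⁻¹) := by fun_prop
  have hSY : Measurable fun ω => ((fun k => S k ω, Y ω) : (Fin K → ℝ) × ℝ) :=
    (measurable_pi_lambda _ hSmeas).prodMk hYmeas
  have hjoint : μ.map (fun ω => (⨆ k, S k ω, Y ω))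
      = ((volume.restrict (Ioi 0)).withDensity fun x =>
          ENNReal.ofReal (∑ k, maxGammaDensityTerm a k x)).prod (unifLaw 0 (α ^ 2)) := by
    rw [← withDensity_ite_pos_eq_restrict, ← map_iSup_pi_gammaLaw ha,
      ← Measure.map_id (μ := unifLaw 0 (α ^ 2)), Measure.map_prod_map _ _ hsup measurable_id,
      ← hlaw, Measure.map_map (hsup.prodMap measurable_id) hSY]
    rfl
  set ν := (volume.restrict (Ioi (0 : ℝ))).withDensity fun x =>
    ENNReal.ofReal (∑ k, maxGammaDensityTerm a k x) with hν
  have hdens : Measurable fun x => ENNReal.ofReal (∑ k, maxGammaDensityTerm a k x) := by fun_prop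
  have htop : ∀ᵐ x ∂volume.restrict (Ioi (0 : ℝ)),
      ENNReal.ofReal (∑ k, maxGammaDensityTerm a k x) < ∞ :=
    ae_of_all _ fun _ => ENNReal.ofReal_lt_top
  have hν_pos : ∀ᵐ x ∂ν, 0 < x :=
    (withDensity_absolutelyContinuous _ _).ae_le (ae_restrict_mem measurableSet_Ioi)
  have hunif_nonneg : ∀ᵐ y ∂unifLaw 0 (α ^ 2), 0 ≤ y :=
    Measure.smul_absolutelyContinuous.ae_le
      ((ae_restrict_mem measurableSet_Icc).mono fun y hy => hy.1)
  have htoReal : ∀ x, 0 < x → (ENNReal.ofReal (∑ k, maxGammaDensityTerm a k x)).toReal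
      = ∑ k, maxGammaDensityTerm a k x := fun x hx =>
    ENNReal.toReal_ofReal (Finset.sum_nonneg fun k _ => maxGammaDensityTerm_nonneg a k hx)
  have hν_id : Integrable (fun x : ℝ => x) ν := by
    rw [hν, integrable_withDensity_iff_integrable_smul' hdens htop]
    refine (integrable_finsetSum Finset.univ fun k _ =>
      integrableOn_maxGammaDensityTerm_mul_id ha k).congr
      ((ae_restrict_iff' measurableSet_Ioi).2 (ae_of_all _ fun x hx => ?_))
    simp only [htoReal x hx, smul_eq_mul, Finset.sum_mul]
  have : SFinite ν := inferInstance
  have hint : Integrable (fun p : ℝ × ℝ => Real.log (1 + (p.1⁻¹ + p.2)⁻¹))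
      (ν.prod (unifLaw 0 (α ^ 2))) := by
    refine (hν_id.comp_fst (unifLaw 0 (α ^ 2))).mono' hf.aestronglyMeasurable ?_
    filter_upwards [Measure.quasiMeasurePreserving_fst.ae hν_pos,
      Measure.quasiMeasurePreserving_snd.ae hunif_nonneg] with p hx hy
    rw [Real.norm_of_nonneg (log_one_add_inv_nonneg hx hy)]
    exact log_one_add_inv_le hx hy
  have hUps : Measurable (UpsMRT α) := by
    unfold UpsMRT
    fun_prop
  have hterm : ∀ k, IntegrableOn (fun x => maxGammaDensityTerm a k x * (1 / α ^ 2 * UpsMRT α x))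
      (Ioi 0) := by
    intro k
    refine (integrableOn_maxGammaDensityTerm_mul_id ha k).mono'
      (by fun_prop) ((ae_restrict_iff' measurableSet_Ioi).2 (ae_of_all _ ?_))
    intro x (hx : 0 < x)
    rw [norm_mul, Real.norm_of_nonneg (maxGammaDensityTerm_nonneg a k hx)]
    refine mul_le_mul_of_nonneg_left ?_ (maxGammaDensityTerm_nonneg a k hx)
    rw [← integral_unifLaw_log_one_add_inv hx]
    refine (norm_integral_le_of_norm_le_const (C := x) ?_).trans_eq (by simp)
    filter_upwards [hunif_nonneg] with y hy
    rw [Real.norm_of_nonneg (log_one_add_inv_nonneg hx hy)]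
    exact log_one_add_inv_le hx hy
  calc ∫ ω, Real.log (1 + ((⨆ k, S k ω)⁻¹ + Y ω)⁻¹) ∂μ
      = ∫ p, Real.log (1 + (p.1⁻¹ + p.2)⁻¹) ∂ν.prod (unifLaw 0 (α ^ 2)) := by
        rw [← hjoint]
        exact (integral_map ((hsup.prodMap measurable_id).comp hSY).aemeasurable
          hf.aestronglyMeasurable).symm
    _ = ∫ x, 1 / α ^ 2 * UpsMRT α x ∂ν := by
        rw [integral_prod _ hint]
        exact integral_congr_ae (hν_pos.mono fun x hx => integral_unifLaw_log_one_add_inv hx)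
    _ = ∫ x in Ioi 0, ∑ k, maxGammaDensityTerm a k x * (1 / α ^ 2 * UpsMRT α x) := by
        rw [hν, integral_withDensity_eq_integral_toReal_smul hdens htop]
        refine setIntegral_congr_fun measurableSet_Ioi fun x hx => ?_
        simp only [htoReal x hx, smul_eq_mul, Finset.sum_mul]
    _ = _ := by
        rw [integral_finsetSum _ fun k _ => hterm k, Finset.mul_sum]
        refine Finset.sum_congr rfl fun k _ => ?_
        rw [← mul_assoc, ← integral_const_mul]
        refine integral_congr_ae (ae_of_all _ fun x => ?_)
        simp only [maxGammaDensityTerm]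
        ring
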